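/- Let φ be a locally Hölder potential on X = [0,1]∖ℚ with φ ≤ 0 and pressure P(φ) = 0, and let μ_φ be its Gibbs measure for the Gauss map. Let f be any locally Hölder observable such that the set {t ∈ ℝ : P(tf + φ) < ∞} contains a neighbourhood of the origin, and set α(f) = ∫ f dμ_φ. Then for every ε > 0 there exist δ > 0 and n₁ ∈ ℕ such that for all n ≥ n₁, μ_φ({x : |S_n f(x) − n·α(f)| > nε}) ≤ e^{−nδ}. -/

import Mathlib

open MeasureTheory Filter Set Topology
open scoped ENNReal NNReal Classical Real

noncomputable section

/-- The Gauss map `T(x) = 1/x mod 1`. -/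
def gaussMap (x : ℝ) : ℝ := Int.fract x⁻¹

/-- The space `X = [0,1] ∖ ℚ` of irrational numbers in the unit interval. -/
def gaussSet : Set ℝ := {x | x ∈ Set.Icc (0:ℝ) 1 ∧ Irrational x}

/-- The first continued fraction digit `a₁(x) = ⌊1/x⌋`. -/
def cfDigit1 (x : ℝ) : ℕ := ⌊x⁻¹⌋₊

/-- The `(i+1)`-th continued fraction digit `a_{i+1}(x) = a₁(Tⁱ x)`. -/
def cfDigit (i : ℕ) (x : ℝ) : ℕ := cfDigit1 (gaussMap^[i] x)

/-- The inverse branch `T_a(x) = 1/(x+a)` of the Gauss map. -/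
def invBranch1 (a : ℕ) (x : ℝ) : ℝ := (x + (a : ℝ))⁻¹

/-- The composed inverse branch `T_𝐚 = T_{a₁} ∘ ⋯ ∘ T_{aₙ}` for `𝐚 = [a₁,…,aₙ]`. -/
def invBranch (l : List ℕ) (x : ℝ) : ℝ := l.foldr invBranch1 x

/-- The cylinder set `I_𝐚` of points of `X` whose first digits are given by `𝐚`. -/
def cylinder (l : List ℕ) : Set ℝ :=
  {x | x ∈ gaussSet ∧ ∀ i : Fin l.length, cfDigit i.1 x = l.get i}

/-- The Birkhoff sum `S_n φ = ∑_{k<n} φ ∘ T^k`. -/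
def birkhoff (φ : ℝ → ℝ) (n : ℕ) (x : ℝ) : ℝ :=
  ∑ k ∈ Finset.range n, φ (gaussMap^[k] x)

/-- The pair `(pₙ(𝐚), qₙ(𝐚))` of numerator and denominator (continuant) of the
finite continued fraction `[a₁,…,aₙ] = pₙ/qₙ`. -/
def contPQ : List ℕ → ℕ × ℕ
  | [] => (0, 1)
  | a :: l => ((contPQ l).2, a * (contPQ l).2 + (contPQ l).1)

/-- The continuant `qₙ(𝐚)`, the denominator of `[a₁,…,aₙ]` in lowest terms. -/
def contQ (l : List ℕ) : ℕ := (contPQ l).2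

/-- Words of length `n` with digits in `ℕ = {1,2,…}`. -/
def Word (n : ℕ) : Type := {l : List ℕ // l.length = n ∧ ∀ a ∈ l, 0 < a}

/-- The periodic point `𝐚^∞` with periodic continued fraction expansion repeating `𝐚`. -/
def periodicPoint (l : List ℕ) : ℝ :=
  limUnder atTop fun k : ℕ => invBranch (List.flatten (List.replicate k l)) (1/2 : ℝ)

/-- The `n`-th partition sum `∑_{𝐚 ∈ ℕⁿ} exp(S_nφ(𝐚^∞))` appearing in the pressure. -/
def partSum (φ : ℝ → ℝ) (n : ℕ) : ℝ≥0∞ :=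
  ∑' l : Word n, ENNReal.ofReal (Real.exp (birkhoff φ n (periodicPoint l.1)))

/-- `φ` has (finite) pressure `P(φ) = p`, i.e. `(1/n) log ∑_{𝐚∈ℕⁿ} exp(S_nφ(𝐚^∞)) → p`. -/
def HasPressure (φ : ℝ → ℝ) (p : ℝ) : Prop :=
  (∀ n : ℕ, 0 < n → partSum φ n ≠ ⊤) ∧
    Tendsto (fun n : ℕ => Real.log (partSum φ n).toReal / (n : ℝ)) atTop (𝓝 p)

/-- The pressure of `φ` is finite: `P(φ) < ∞`. -/
def PressureFinite (φ : ℝ → ℝ) : Prop := ∃ p : ℝ, HasPressure φ p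

/-- `φ` is locally Hölder: oscillation on `n`-cylinders decays geometrically. -/
def LocHolder (φ : ℝ → ℝ) : Prop :=
  ∃ C > (0:ℝ), ∃ θ ∈ Set.Ioo (0:ℝ) 1, ∀ l : List ℕ, l ≠ [] → (∀ a ∈ l, 0 < a) →
    ∀ x ∈ cylinder l, ∀ y ∈ cylinder l, |φ x - φ y| ≤ C * θ ^ l.length

/-- The normalization `𝓛_φ 1 = 1` of the Ruelle transfer operator of `φ`. -/
def TransferNormalized (φ : ℝ → ℝ) : Prop :=
  ∀ x ∈ gaussSet, ∑' a : ℕ+, Real.exp (φ (invBranch1 (a : ℕ) x)) = 1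

/-- `μ` is invariant under the Gauss map. -/
def GaussInvariant (μ : Measure ℝ) : Prop :=
  ∀ s : Set ℝ, MeasurableSet s → μ (gaussMap ⁻¹' s) = μ s

/-- The Gibbs property for the potential `φ` (with `P(φ) = 0`):
`C⁻¹ e^{S_nφ(T_𝐚 x)} ≤ μ(I_𝐚) ≤ C e^{S_nφ(T_𝐚 x)}`. -/
def IsGibbs (φ : ℝ → ℝ) (μ : Measure ℝ) : Prop :=
  ∃ C : ℝ, 1 ≤ C ∧ ∀ l : List ℕ, l ≠ [] → (∀ a ∈ l, 0 < a) → ∀ x ∈ gaussSet,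
    C⁻¹ * Real.exp (birkhoff φ l.length (invBranch l x)) ≤ (μ (cylinder l)).toReal ∧
      (μ (cylinder l)).toReal ≤ C * Real.exp (birkhoff φ l.length (invBranch l x))

/-- The Kolmogorov–Sinai entropy of `μ`:
`h = lim (1/n) ∑_{𝐚∈ℕⁿ} -μ(I_𝐚) log μ(I_𝐚)`. -/
def HasEntropy (μ : Measure ℝ) (h : ℝ) : Prop :=
  Tendsto (fun n : ℕ => (∑' l : Word n, Real.negMulLog (μ (cylinder l.1)).toReal) / (n : ℝ))
    atTop (𝓝 h)

/-- `log |T'| (x) = log (1/x²)` for the Gauss map. -/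
def logAbsDerivGauss (x : ℝ) : ℝ := Real.log (1 / x ^ 2)

/-- The observable `ψ = -log |T'|`. -/
def gaussPsi (x : ℝ) : ℝ := -Real.log (1 / x ^ 2)

/-- The Lyapunov exponent `λ_μ = ∫ log|T'| dμ`. -/
def lyapunov (μ : Measure ℝ) : ℝ := ∫ x, logAbsDerivGauss x ∂μ

/-- The polynomial tail condition `μ({x : a₁(x) ≥ n}) = O(n^{-δ})`. -/
def PolyTail (μ : Measure ℝ) : Prop :=
  ∃ δ > (0:ℝ), ∃ K : ℝ, ∀ n : ℕ, 0 < n →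
    (μ {x | x ∈ gaussSet ∧ n ≤ cfDigit1 x}).toReal ≤ K * (n : ℝ) ^ (-δ)

/-- The Fourier transform `μ̂(ξ) = ∫ e^{-2πiξx} dμ(x)`. -/
def muFourier (μ : Measure ℝ) (ξ : ℝ) : ℂ :=
  ∫ x, Complex.exp (-(2 * Real.pi * ξ * x : ℝ) * Complex.I) ∂μ

/-- A sequence `u` equidistributes modulo 1. -/
def EquidistributedMod1 (u : ℕ → ℝ) : Prop :=
  ∀ a b : ℝ, 0 ≤ a → a ≤ b → b ≤ 1 →
    Tendsto (fun N : ℕ =>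
        (((Finset.range N).filter fun k => Int.fract (u k) ∈ Set.Ico a b).card : ℝ) / (N : ℝ))
      atTop (𝓝 (b - a))

/-- The set `B(𝒜)` of `𝒜`-badly approximable numbers: all digits lie in `𝒜`. -/
def badSet (A : Finset ℕ) : Set ℝ := {x | x ∈ gaussSet ∧ ∀ i : ℕ, cfDigit i x ∈ A}

/-- Locally Hölder on the subsystem `B(𝒜)`. -/
def LocHolderOn (A : Finset ℕ) (φ : ℝ → ℝ) : Prop :=
  ∃ C > (0:ℝ), ∃ θ ∈ Set.Ioo (0:ℝ) 1, ∀ l : List ℕ, l ≠ [] → (∀ a ∈ l, a ∈ A) →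
    ∀ x ∈ cylinder l ∩ badSet A, ∀ y ∈ cylinder l ∩ badSet A,
      |φ x - φ y| ≤ C * θ ^ l.length

/-- The Gibbs property for the Gauss map restricted to `B(𝒜)`. -/
def IsGibbsOn (A : Finset ℕ) (φ : ℝ → ℝ) (μ : Measure ℝ) : Prop :=
  ∃ C : ℝ, 1 ≤ C ∧ ∀ l : List ℕ, l ≠ [] → (∀ a ∈ l, a ∈ A) → ∀ x ∈ badSet A,
    C⁻¹ * Real.exp (birkhoff φ l.length (invBranch l x)) ≤ (μ (cylinder l)).toReal ∧
      (μ (cylinder l)).toReal ≤ C * Real.exp (birkhoff φ l.length (invBranch l x))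

/-- The `n`-regular set `A_n(ε)` of the large deviation decomposition. -/
def regSet (φ : ℝ → ℝ) (lam s ε : ℝ) (n : ℕ) : Set ℝ :=
  {x | |birkhoff gaussPsi n x / (n : ℝ) + lam| < ε ∧
       |birkhoff φ n x / birkhoff gaussPsi n x - s| < ε}

/-- The collection `𝓡ₙ` of `n`-regular words. -/
def regWords (φ : ℝ → ℝ) (lam s ε : ℝ) (n : ℕ) : Set (List ℕ) :=
  {l | l.length = n ∧ (∀ a ∈ l, 0 < a) ∧
       ∀ k : ℕ, n / 2 ≤ k → k ≤ n → cylinder (l.take k) ⊆ regSet φ lam s ε k}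

/-- The union `Rₙ` of the `n`-regular cylinders. -/
def regUnion (φ : ℝ → ℝ) (lam s ε : ℝ) (n : ℕ) : Set ℝ :=
  ⋃ l ∈ regWords φ lam s ε n, cylinder l

end

noncomputable section

/-- The word formed by the first `n` continued fraction digits of `x`. -/
def cfWord : ℕ → ℝ → List ℕ
  | 0, _ => []
  | n + 1, x => cfDigit1 x :: cfWord n (gaussMap x)

section GaussMap

variable {x y : ℝ} {a n : ℕ} {l : List ℕ}

lemma gaussSet_pos (hx : x ∈ gaussSet) : 0 < x :=
  lt_of_le_of_ne hx.1.1 (by simpa using (hx.2.ne_nat 0).symm)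

lemma gaussSet_lt_one (hx : x ∈ gaussSet) : x < 1 :=
  lt_of_le_of_ne hx.1.2 (by simpa using hx.2.ne_nat 1)

lemma gaussMap_mem (hx : x ∈ gaussSet) : gaussMap x ∈ gaussSet := by
  refine ⟨⟨Int.fract_nonneg _, (Int.fract_lt_one _).le⟩, ?_⟩
  unfold gaussMap Int.fract
  exact hx.2.inv.sub_intCast _

lemma gaussMap_iterate_mem (hx : x ∈ gaussSet) (n : ℕ) : gaussMap^[n] x ∈ gaussSet := by
  induction n generalizing x with
  | zero => exact hx
  | succ n ih => exact ih (gaussMap_mem hx)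

lemma cfDigit1_pos (hx : x ∈ gaussSet) : 0 < cfDigit1 x :=
  Nat.floor_pos.2 (one_lt_inv_iff₀.2 ⟨gaussSet_pos hx, gaussSet_lt_one hx⟩).le

lemma invBranch1_cfDigit1 (hx : x ∈ gaussSet) : invBranch1 (cfDigit1 x) (gaussMap x) = x := by
  unfold invBranch1 cfDigit1 gaussMap
  rw [natCast_floor_eq_intCast_floor (inv_nonneg.2 (gaussSet_pos hx).le), Int.fract_add_floor,
    inv_inv]

lemma invBranch1_mem (ha : 0 < a) (hy : y ∈ gaussSet) : invBranch1 a y ∈ gaussSet := by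
  have h1 : (1 : ℝ) ≤ a := by exact_mod_cast ha
  have hy0 := gaussSet_pos hy
  exact ⟨⟨by unfold invBranch1; positivity, inv_le_one_of_one_le₀ (by linarith)⟩,
    (hy.2.add_natCast a).inv⟩

lemma gaussMap_invBranch1 (a : ℕ) (hy : y ∈ gaussSet) : gaussMap (invBranch1 a y) = y := by
  unfold gaussMap invBranch1
  rw [inv_inv, Int.fract_add_natCast, Int.fract_eq_self]
  exact ⟨hy.1.1, gaussSet_lt_one hy⟩

lemma cfDigit1_invBranch1 (a : ℕ) (hy : y ∈ gaussSet) : cfDigit1 (invBranch1 a y) = a := by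
  unfold cfDigit1 invBranch1
  rw [inv_inv, Nat.floor_add_natCast hy.1.1, Nat.floor_eq_zero.2 (gaussSet_lt_one hy), zero_add]

lemma length_cfWord (n : ℕ) (x : ℝ) : (cfWord n x).length = n := by
  induction n generalizing x with
  | zero => rfl
  | succ n ih => simp [cfWord, ih]

lemma cfWord_pos (hx : x ∈ gaussSet) (n : ℕ) : ∀ a ∈ cfWord n x, 0 < a := by
  induction n generalizing x with
  | zero => simp [cfWord]
  | succ n ih =>
    simp only [cfWord, List.mem_cons, forall_eq_or_imp]
    exact ⟨cfDigit1_pos hx, ih (gaussMap_mem hx)⟩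

lemma cfWord_add (m n : ℕ) (x : ℝ) :
    cfWord (m + n) x = cfWord m x ++ cfWord n (gaussMap^[m] x) := by
  induction m generalizing x with
  | zero => simp [cfWord]
  | succ m ih => simp [Nat.succ_add, cfWord, ih]

lemma mem_cylinder_iff : x ∈ cylinder l ↔ x ∈ gaussSet ∧ cfWord l.length x = l := by
  refine and_congr_right fun hx => ?_
  induction l generalizing x with
  | nil => simp [cfWord]
  | cons a l ih =>
    simp only [List.length_cons, cfWord, List.cons.injEq]
    exact Fin.forall_fin_succ.trans (and_congr Iff.rfl (ih (gaussMap_mem hx)))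

lemma mem_cylinder_cfWord (hx : x ∈ gaussSet) (n : ℕ) : x ∈ cylinder (cfWord n x) :=
  mem_cylinder_iff.2 ⟨hx, by rw [length_cfWord]⟩

lemma invBranch_mem (hl : ∀ a ∈ l, 0 < a) (hy : y ∈ gaussSet) : invBranch l y ∈ gaussSet := by
  induction l with
  | nil => exact hy
  | cons a l ih =>
    simp only [List.mem_cons, forall_eq_or_imp] at hl
    exact invBranch1_mem hl.1 (ih hl.2)

lemma iterate_invBranch (hl : ∀ a ∈ l, 0 < a) (hy : y ∈ gaussSet) :
    gaussMap^[l.length] (invBranch l y) = y := by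
  induction l with
  | nil => rfl
  | cons a l ih =>
    simp only [List.mem_cons, forall_eq_or_imp] at hl
    rw [List.length_cons, Function.iterate_succ_apply]
    change gaussMap^[l.length] (gaussMap (invBranch1 a (invBranch l y))) = y
    rw [gaussMap_invBranch1 a (invBranch_mem hl.2 hy), ih hl.2]

lemma cfWord_invBranch (hl : ∀ a ∈ l, 0 < a) (hy : y ∈ gaussSet) :
    cfWord l.length (invBranch l y) = l := by
  induction l with
  | nil => rfl
  | cons a l ih =>
    simp only [List.mem_cons, forall_eq_or_imp] at hl
    change cfDigit1 (invBranch1 a (invBranch l y)) ::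
      cfWord l.length (gaussMap (invBranch1 a (invBranch l y))) = _
    rw [gaussMap_invBranch1 a (invBranch_mem hl.2 hy),
      cfDigit1_invBranch1 a (invBranch_mem hl.2 hy), ih hl.2]

lemma invBranch_append (l l' : List ℕ) (y : ℝ) :
    invBranch (l ++ l') y = invBranch l (invBranch l' y) := by
  simp [invBranch]

lemma birkhoff_add (f : ℝ → ℝ) (m n : ℕ) (x : ℝ) :
    birkhoff f (m + n) x = birkhoff f m x + birkhoff f n (gaussMap^[m] x) := by
  simp only [birkhoff, Finset.sum_range_add, ← Function.iterate_add_apply, add_comm]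

lemma birkhoff_succ (f : ℝ → ℝ) (n : ℕ) (x : ℝ) :
    birkhoff f (n + 1) x = f x + birkhoff f n (gaussMap x) := by
  simp [birkhoff, Finset.sum_range_succ', add_comm]

/-- Points of `X` sharing their first `2m` digits are `2⁻ᵐ`-close. -/
lemma abs_sub_le_of_cfWord_eq (m : ℕ) (hx : x ∈ gaussSet) (hy : y ∈ gaussSet)
    (h : cfWord (2 * m) x = cfWord (2 * m) y) : |x - y| ≤ (1 / 2) ^ m := by
  have step : ∀ {u v : ℝ}, u ∈ gaussSet → v ∈ gaussSet → cfDigit1 u = cfDigit1 v →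
      |u - v| = u * v * |gaussMap u - gaussMap v| := by
    intro u v hu hv huv
    have hu0 := gaussSet_pos hu
    have hv0 := gaussSet_pos hv
    have e : gaussMap u - gaussMap v = (v - u) / (u * v) := by
      have h1 : gaussMap u = u⁻¹ - cfDigit1 u := by
        have := congrArg (·⁻¹) (invBranch1_cfDigit1 hu)
        simp only [invBranch1, inv_inv] at this
        linarith
      have h2 : gaussMap v = v⁻¹ - cfDigit1 v := by
        have := congrArg (·⁻¹) (invBranch1_cfDigit1 hv)
        simp only [invBranch1, inv_inv] at this
        linarith
      rw [h1, h2, huv]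
      field_simp
      ring
    rw [e, abs_div, abs_of_pos (mul_pos hu0 hv0), abs_sub_comm]
    field_simp
  have half : ∀ {u : ℝ}, u ∈ gaussSet → u * gaussMap u ≤ 1 / 2 := by
    intro u hu
    have hu0 := gaussSet_pos hu
    have h1 : (1 : ℝ) ≤ cfDigit1 u := by exact_mod_cast cfDigit1_pos hu
    have hT := gaussSet_lt_one (gaussMap_mem hu)
    have h2 : u * (gaussMap u + cfDigit1 u) = 1 := by
      have := invBranch1_cfDigit1 hu
      unfold invBranch1 at this
      have hpos : 0 < gaussMap u + cfDigit1 u := by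
        linarith [gaussSet_pos (gaussMap_mem hu)]
      calc u * (gaussMap u + cfDigit1 u)
          = (gaussMap u + cfDigit1 u)⁻¹ * (gaussMap u + cfDigit1 u) := by rw [this]
        _ = 1 := inv_mul_cancel₀ hpos.ne'
    nlinarith
  induction m generalizing x y with
  | zero =>
    simp only [pow_zero, abs_le]
    constructor <;> linarith [hx.1.1, hx.1.2, hy.1.1, hy.1.2]
  | succ m ih =>
    have e : 2 * (m + 1) = 2 * m + 1 + 1 := by ring
    simp only [e, cfWord, List.cons.injEq] at h
    have hx' := gaussMap_mem hx
    have hy' := gaussMap_mem hy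
    rw [step hx hy h.1, step hx' hy' h.2.1]
    have := ih (gaussMap_mem hx') (gaussMap_mem hy') h.2.2
    have h1 : 0 ≤ x * gaussMap x := mul_nonneg hx.1.1 hx'.1.1
    have h2 : 0 ≤ y * gaussMap y := mul_nonneg hy.1.1 hy'.1.1
    calc x * y * (gaussMap x * gaussMap y * |gaussMap (gaussMap x) - gaussMap (gaussMap y)|)
        = (x * gaussMap x) * (y * gaussMap y) *
          |gaussMap (gaussMap x) - gaussMap (gaussMap y)| := by ring
      _ ≤ (1 / 2) * 1 * (1 / 2) ^ m := by
        gcongr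
        · exact half hx
        · exact (half hy).trans (by norm_num)
      _ = (1 / 2) ^ (m + 1) := by ring

/-- The fixed point of the branch `T_a`. -/
def branchFixedPoint (a : ℕ) : ℝ := (√((a ^ 2 + 4 : ℕ) : ℝ) - a) / 2

lemma branchFixedPoint_mul (a : ℕ) :
    branchFixedPoint a * (branchFixedPoint a + a) = 1 := by
  have h := Real.sq_sqrt (x := ((a ^ 2 + 4 : ℕ) : ℝ)) (by positivity)
  unfold branchFixedPoint
  push_cast at h ⊢
  nlinarith

lemma branchFixedPoint_pos (a : ℕ) : 0 < branchFixedPoint a := by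
  have : (a : ℝ) < √((a ^ 2 + 4 : ℕ) : ℝ) := by
    apply Real.lt_sqrt_of_sq_lt
    push_cast
    linarith
  unfold branchFixedPoint
  linarith

lemma invBranch1_branchFixedPoint (a : ℕ) :
    invBranch1 a (branchFixedPoint a) = branchFixedPoint a :=
  inv_eq_of_mul_eq_one_left (branchFixedPoint_mul a)

lemma branchFixedPoint_lt_one (ha : 0 < a) : branchFixedPoint a < 1 := by
  have h1 : (1 : ℝ) ≤ a := by exact_mod_cast ha
  nlinarith [branchFixedPoint_mul a, branchFixedPoint_pos a]

lemma branchFixedPoint_mem (ha : 0 < a) : branchFixedPoint a ∈ gaussSet := by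
  refine ⟨⟨(branchFixedPoint_pos a).le, (branchFixedPoint_lt_one ha).le⟩, ?_⟩
  have hs : ¬ IsSquare (a ^ 2 + 4) := by
    rintro ⟨k, hk⟩
    have h1 : a < k := by nlinarith
    have h2 : k < a + 2 := by nlinarith
    have h3 : k = a + 1 := by omega
    subst h3
    have : 4 = 2 * a + 1 := by nlinarith
    omega
  have := (irrational_sqrt_natCast_iff.2 hs).sub_natCast a
  exact this.div_natCast (m := 2) (by norm_num)

lemma periodicPoint_singleton (ha : 0 < a) : periodicPoint [a] = branchFixedPoint a := by
  have h1 : (1 : ℝ) ≤ a := by exact_mod_cast ha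
  set p := branchFixedPoint a with hp
  have hp0 : 0 < p := branchFixedPoint_pos a
  have hp1 : p < 1 := branchFixedPoint_lt_one ha
  refine Tendsto.limUnder_eq ?_
  have key : ∀ k : ℕ, 0 ≤ invBranch (List.flatten (List.replicate k [a])) (1 / 2 : ℝ) ∧
      |invBranch (List.flatten (List.replicate k [a])) (1 / 2 : ℝ) - p| ≤ p ^ k := by
    intro k
    induction k with
    | zero =>
      simp only [List.replicate_zero, List.flatten_nil, invBranch, List.foldr_nil, pow_zero]
      exact ⟨by norm_num, abs_le.2 ⟨by linarith, by linarith⟩⟩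
    | succ k ih =>
      set u := invBranch (List.flatten (List.replicate k [a])) (1 / 2 : ℝ)
      have e : invBranch (List.flatten (List.replicate (k + 1) [a])) (1 / 2 : ℝ) =
          (u + a)⁻¹ := rfl
      rw [e]
      have hu : 0 < u + a := by linarith [ih.1]
      refine ⟨(inv_pos.2 hu).le, ?_⟩
      have e2 : (u + a)⁻¹ - p = (u + a)⁻¹ * (p * (p - u)) := by
        have h := branchFixedPoint_mul a
        rw [← hp] at h
        field_simp
        linarith
      have h3 : (u + a)⁻¹ ≤ 1 := inv_le_one_of_one_le₀ (by linarith [ih.1])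
      rw [e2, abs_mul, abs_mul, abs_of_pos (inv_pos.2 hu), abs_of_pos hp0, abs_sub_comm, pow_succ,
        mul_comm (p ^ k)]
      calc (u + a)⁻¹ * (p * |u - p|) ≤ 1 * (p * p ^ k) := by
            gcongr
            exact ih.2
        _ = p * p ^ k := one_mul _
  rw [tendsto_iff_dist_tendsto_zero]
  exact squeeze_zero (fun _ => dist_nonneg) (fun k => (key k).2)
    (tendsto_pow_atTop_nhds_zero_of_lt_one hp0.le hp1)

end GaussMap
end

noncomputable section

/-- Local Hölder continuity bounds the oscillation of points sharing their first digits. -/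
lemma LocHolder.exists_cfWord_bound {f : ℝ → ℝ} (hf : LocHolder f) :
    ∃ C > (0 : ℝ), ∃ θ ∈ Ioo (0 : ℝ) 1, ∀ n, 0 < n → ∀ x ∈ gaussSet, ∀ y ∈ gaussSet,
      cfWord n x = cfWord n y → |f x - f y| ≤ C * θ ^ n := by
  obtain ⟨C, hC, θ, hθ, h⟩ := hf
  refine ⟨C, hC, θ, hθ, fun n hn x hx y hy hxy => ?_⟩
  have := h (cfWord n x) (by
    intro h0
    have := length_cfWord n x
    simp [h0] at this
    omega) (cfWord_pos hx n) x (mem_cylinder_cfWord hx n) y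
      (hxy ▸ mem_cylinder_cfWord hy n)
  rwa [length_cfWord] at this

/-- Bounded distortion of Birkhoff sums. -/
lemma LocHolder.exists_birkhoff_bound {f : ℝ → ℝ} (hf : LocHolder f) :
    ∃ K > (0 : ℝ), ∀ n, ∀ x ∈ gaussSet, ∀ y ∈ gaussSet,
      cfWord n x = cfWord n y → |birkhoff f n x - birkhoff f n y| ≤ K := by
  obtain ⟨C, hC, θ, hθ, h⟩ := hf.exists_cfWord_bound
  have hsum := summable_geometric_of_lt_one hθ.1.le hθ.2
  refine ⟨C * (1 - θ)⁻¹, mul_pos hC (inv_pos.2 (by linarith [hθ.2])), fun n x hx y hy hxy => ?_⟩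
  have key : |birkhoff f n x - birkhoff f n y| ≤ C * ∑ k ∈ Finset.range n, θ ^ (k + 1) := by
    induction n generalizing x y with
    | zero => simp [birkhoff]
    | succ n ih =>
      have h1 := h (n + 1) n.succ_pos x hx y hy hxy
      simp only [cfWord, List.cons.injEq] at hxy
      have h2 := ih _ (gaussMap_mem hx) _ (gaussMap_mem hy) hxy.2
      rw [birkhoff_succ, birkhoff_succ, Finset.sum_range_succ, mul_add]
      calc |f x + birkhoff f n (gaussMap x) - (f y + birkhoff f n (gaussMap y))|
          = |(birkhoff f n (gaussMap x) - birkhoff f n (gaussMap y)) + (f x - f y)| := by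
            congr 1; ring
        _ ≤ _ := (abs_add_le _ _).trans (add_le_add h2 h1)
  refine key.trans (mul_le_mul_of_nonneg_left ?_ hC.le)
  rw [← tsum_geometric_of_lt_one hθ.1.le hθ.2]
  refine le_trans (Finset.sum_le_sum fun k _ => ?_) (hsum.sum_le_tsum _ fun k _ => by
    have := hθ.1; positivity)
  exact pow_le_pow_of_le_one hθ.1.le hθ.2.le k.le_succ

instance : MeasurableSpace (List ℕ) := ⊤

lemma measurable_gaussMap : Measurable gaussMap := measurable_inv.fract

lemma measurable_cfDigit1 : Measurable cfDigit1 := Nat.measurable_floor.comp measurable_inv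

lemma measurable_cfWord (n : ℕ) : Measurable (cfWord n) := by
  induction n with
  | zero => exact measurable_const
  | succ n ih =>
    exact (Measurable.of_discrete (f := fun p : ℕ × List ℕ => p.1 :: p.2)).comp
      (measurable_cfDigit1.prodMk (ih.comp measurable_gaussMap))

lemma measurableSet_gaussSet : MeasurableSet gaussSet :=
  measurableSet_Icc.inter (Set.countable_range ((↑) : ℚ → ℝ)).measurableSet.compl

lemma measurableSet_cylinder (l : List ℕ) : MeasurableSet (cylinder l) := by
  have : cylinder l = gaussSet ∩ cfWord l.length ⁻¹' {l} := by
    ext x; exact mem_cylinder_iff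
  rw [this]
  exact measurableSet_gaussSet.inter (measurable_cfWord _ (.of_discrete))

lemma measure_le_of_singleton_le {α : Type*} [MeasurableSpace α] [Countable α]
    [MeasurableSingletonClass α] {ρ₁ ρ₂ : Measure α} (h : ∀ a, ρ₁ {a} ≤ ρ₂ {a}) : ρ₁ ≤ ρ₂ := by
  refine Measure.le_iff.2 fun s hs => ?_
  rw [← Measure.tsum_indicator_apply_singleton ρ₁ s hs,
    ← Measure.tsum_indicator_apply_singleton ρ₂ s hs]
  exact ENNReal.tsum_le_tsum fun a => Set.indicator_le_indicator (h a)

lemma measure_cfWord_preimage {ν : Measure ℝ} (hν : ν gaussSetᶜ = 0) (l : List ℕ) :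
    ν (cfWord l.length ⁻¹' {l}) = ν (cylinder l) := by
  have : cylinder l = cfWord l.length ⁻¹' {l} ∩ gaussSet := by
    ext x; rw [mem_cylinder_iff, and_comm]; rfl
  rw [this, measure_inter_conull' (measure_mono_null (fun x hx => hx.2) hν)]

/-- Measures on `X` can be compared on cylinders. -/
lemma measure_le_of_cylinder_le {ν₁ ν₂ : Measure ℝ} [IsFiniteMeasure ν₂]
    (h₁ : ν₁ gaussSetᶜ = 0)
    (h : ∀ l : List ℕ, (∀ a ∈ l, 0 < a) → ν₁ (cylinder l) ≤ ν₂ (cylinder l)) : ν₁ ≤ ν₂ := by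
  have hmap : ∀ n, (ν₁.restrict gaussSet).map (cfWord n) ≤
      (ν₂.restrict gaussSet).map (cfWord n) := by
    intro n
    refine measure_le_of_singleton_le fun l => ?_
    rw [Measure.map_apply (measurable_cfWord n) .of_discrete,
      Measure.map_apply (measurable_cfWord n) .of_discrete,
      Measure.restrict_apply (measurable_cfWord n .of_discrete),
      Measure.restrict_apply (measurable_cfWord n .of_discrete)]
    rcases (cfWord n ⁻¹' {l} ∩ gaussSet).eq_empty_or_nonempty with h0 | ⟨x, hx, hxX⟩
    · simp [h0]
    · have hx : cfWord n x = l := hx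
      have hl : l.length = n := hx ▸ length_cfWord n x
      have e : cfWord n ⁻¹' {l} ∩ gaussSet = cylinder l := by
        ext y
        rw [mem_cylinder_iff, and_comm, hl]
        rfl
      rw [e]
      exact h l (hx ▸ cfWord_pos hxX n)
  have hopen : ∀ U : Set ℝ, IsOpen U → ν₁ U ≤ ν₂ U := by
    intro U hU
    set W : ℕ → Set ℝ := fun n => cfWord n ⁻¹' {l | cylinder l ⊆ U} ∩ gaussSet with hW
    have hWle : ∀ n, ν₁ (W n) ≤ ν₂ U := by
      intro n
      have hm := Measure.le_iff'.1 (hmap n) {l | cylinder l ⊆ U}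
      rw [Measure.map_apply (measurable_cfWord n) .of_discrete,
        Measure.map_apply (measurable_cfWord n) .of_discrete,
        Measure.restrict_apply (measurable_cfWord n .of_discrete),
        Measure.restrict_apply (measurable_cfWord n .of_discrete)] at hm
      exact hm.trans (measure_mono fun x hx => hx.1 (mem_cylinder_cfWord hx.2 n))
    have hWmono : Monotone W := by
      refine monotone_nat_of_le_succ fun n x hx => ⟨fun y hy => hx.1 ?_, hx.2⟩
      rw [mem_cylinder_iff, length_cfWord] at hy ⊢
      refine ⟨hy.1, ?_⟩
      have := hy.2
      rw [cfWord_add, cfWord_add] at this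
      exact (List.append_inj this (by simp [length_cfWord])).1
    have hUW : U ∩ gaussSet ⊆ ⋃ n, W n := by
      rintro x ⟨hxU, hxX⟩
      obtain ⟨r, hr, hball⟩ := Metric.isOpen_iff.1 hU x hxU
      obtain ⟨m, hm⟩ := exists_pow_lt_of_lt_one hr (by norm_num : (1 / 2 : ℝ) < 1)
      refine mem_iUnion.2 ⟨2 * m, fun y hy => hball ?_, hxX⟩
      rw [mem_cylinder_iff, length_cfWord] at hy
      exact (abs_sub_le_of_cfWord_eq m hy.1 hxX hy.2).trans_lt hm
    calc ν₁ U = ν₁ (U ∩ gaussSet) :=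
          (measure_inter_conull' (measure_mono_null (fun x hx => hx.2) h₁)).symm
      _ ≤ ν₁ (⋃ n, W n) := measure_mono hUW
      _ = ⨆ n, ν₁ (W n) := hWmono.measure_iUnion
      _ ≤ ν₂ U := iSup_le hWle
  refine Measure.le_iff'.2 fun s => ?_
  rw [Set.measure_eq_iInf_isOpen s ν₂]
  exact le_iInf₂ fun U hsU => le_iInf fun hU => (measure_mono hsU).trans (hopen U hU)

end

noncomputable section

lemma cylinder_nil : cylinder [] = gaussSet := by
  ext x
  simp [mem_cylinder_iff, cfWord]

lemma cylinder_append (l l' : List ℕ) :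
    cylinder (l ++ l') = cylinder l ∩ gaussMap^[l.length] ⁻¹' cylinder l' := by
  ext x
  simp only [mem_inter_iff, mem_preimage, mem_cylinder_iff, List.length_append, cfWord_add]
  constructor
  · rintro ⟨hx, h⟩
    have := List.append_inj h (by simp [length_cfWord])
    exact ⟨⟨hx, this.1⟩, gaussMap_iterate_mem hx _, this.2⟩
  · rintro ⟨⟨hx, h⟩, -, h'⟩
    exact ⟨hx, by rw [h, h']⟩

/-- Cylinders are independent under `μ`, up to the factor `D`. -/
def QuasiBernoulli (D : ℝ≥0) (μ : Measure ℝ) : Prop :=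
  ∀ l l' : List ℕ, (∀ a ∈ l, 0 < a) → (∀ a ∈ l', 0 < a) →
    μ (cylinder (l ++ l')) ≤ D * (μ (cylinder l) * μ (cylinder l')) ∧
      μ (cylinder l) * μ (cylinder l') ≤ D * μ (cylinder (l ++ l'))

lemma IsGibbs.exists_quasiBernoulli {φ : ℝ → ℝ} {μ : Measure ℝ} [IsProbabilityMeasure μ]
    (hμX : μ gaussSet = 1) (h : IsGibbs φ μ) : ∃ D : ℝ≥0, 1 ≤ D ∧ QuasiBernoulli D μ := by
  obtain ⟨C, hC, h⟩ := h
  have hC0 : 0 < C := by linarith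
  have hD : (1 : ℝ≥0) ≤ Real.toNNReal (C ^ 3) :=
    Real.one_le_toNNReal.2 (one_le_pow₀ hC)
  have hD' : (1 : ℝ≥0∞) ≤ (Real.toNNReal (C ^ 3) : ℝ≥0) := by exact_mod_cast hD
  refine ⟨Real.toNNReal (C ^ 3), hD, fun l l' hl hl' => ?_⟩
  rcases eq_or_ne l [] with rfl | hne
  · rw [cylinder_nil, hμX, one_mul, List.nil_append]
    exact ⟨le_mul_of_one_le_left' hD', le_mul_of_one_le_left' hD'⟩
  rcases eq_or_ne l' [] with rfl | hne'
  · rw [cylinder_nil, hμX, mul_one, List.append_nil]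
    exact ⟨le_mul_of_one_le_left' hD', le_mul_of_one_le_left' hD'⟩
  have hy := branchFixedPoint_mem one_pos
  set y := branchFixedPoint 1
  have hy' := invBranch_mem hl' hy
  obtain ⟨h1, h2⟩ := h l hne hl _ hy'
  obtain ⟨h3, h4⟩ := h l' hne' hl' _ hy
  obtain ⟨h5, h6⟩ := h (l ++ l') (by simp [hne])
    (fun a ha => (List.mem_append.1 ha).elim (hl a) (hl' a)) _ hy
  rw [List.length_append, birkhoff_add, invBranch_append, iterate_invBranch hl hy', Real.exp_add]
    at h5 h6
  rw [inv_mul_le_iff₀ hC0] at h1 h3 h5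
  set u := Real.exp (birkhoff φ l.length (invBranch l (invBranch l' y)))
  set v := Real.exp (birkhoff φ l'.length (invBranch l' y))
  have hu : 0 < u := Real.exp_pos _
  have hv : 0 < v := Real.exp_pos _
  have fin : ∀ s, μ s ≠ ⊤ := measure_ne_top μ
  constructor
  · rw [← ENNReal.toReal_le_toReal (fin _) (by finiteness)]
    simp only [ENNReal.toReal_mul, ENNReal.coe_toReal, Real.coe_toNNReal _ (pow_pos hC0 3).le]
    calc _ ≤ C * (u * v) := h6
      _ ≤ C * ((C * (μ (cylinder l)).toReal) * (C * (μ (cylinder l')).toReal)) := by gcongr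
      _ = _ := by ring
  · rw [← ENNReal.toReal_le_toReal (by finiteness) (by finiteness)]
    simp only [ENNReal.toReal_mul, ENNReal.coe_toReal, Real.coe_toNNReal _ (pow_pos hC0 3).le]
    calc _ ≤ (C * u) * (C * v) := by gcongr
      _ = C ^ 2 * (u * v) := by ring
      _ ≤ C ^ 2 * (C * (μ (cylinder (l ++ l'))).toReal) := by gcongr
      _ = _ := by ring

lemma GaussInvariant.measurePreserving {μ : Measure ℝ} (h : GaussInvariant μ) :
    MeasurePreserving gaussMap μ μ :=
  ⟨measurable_gaussMap, Measure.ext fun s hs => by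
    rw [Measure.map_apply measurable_gaussMap hs, h s hs]⟩

/-- The lower quasi-Bernoulli bound forces ergodicity. -/
lemma QuasiBernoulli.ergodic {D : ℝ≥0} {μ : Measure ℝ} [IsProbabilityMeasure μ]
    (hμX : μ gaussSetᶜ = 0) (hinv : GaussInvariant μ) (h : QuasiBernoulli D μ) :
    Ergodic gaussMap μ := by
  have hiter : ∀ n, Measurable gaussMap^[n] := measurable_gaussMap.iterate
  have h1 : ∀ l : List ℕ, (∀ a ∈ l, 0 < a) → ∀ B, MeasurableSet B →
      μ (cylinder l) * μ B ≤ D * μ (cylinder l ∩ gaussMap^[l.length] ⁻¹' B) := by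
    intro l hl B hB
    have key : μ (cylinder l) • μ ≤ D • (μ.restrict (cylinder l)).map gaussMap^[l.length] := by
      refine measure_le_of_cylinder_le (by simp [hμX]) fun l' hl' => ?_
      have := (h l l' hl hl').2
      rw [cylinder_append, inter_comm] at this
      rw [Measure.smul_apply, Measure.smul_apply,
        Measure.map_apply (hiter _) (measurableSet_cylinder _),
        Measure.restrict_apply (hiter _ (measurableSet_cylinder _))]
      exact this
    have := Measure.le_iff'.1 key B
    rw [Measure.smul_apply, Measure.smul_apply, Measure.map_apply (hiter _) hB,
        Measure.restrict_apply (hiter _ hB), inter_comm] at this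
    exact this
  refine ⟨hinv.measurePreserving, ⟨fun A hA hTA => ?_⟩⟩
  have hTn : ∀ n, gaussMap^[n] ⁻¹' A = A := fun n => by
    rw [preimage_iterate_eq]
    exact Function.iterate_fixed hTA n
  have key : μ A • μ ≤ D • μ.restrict A := by
    refine measure_le_of_cylinder_le (by simp [hμX]) fun l hl => ?_
    have := h1 l hl A hA
    rw [hTn, mul_comm] at this
    rw [Measure.smul_apply, Measure.smul_apply, Measure.restrict_apply' hA]
    exact this
  have h0 := Measure.le_iff'.1 key Aᶜ
  rw [Measure.smul_apply, Measure.smul_apply, Measure.restrict_apply' hA, compl_inter_self,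
    measure_empty, smul_zero, nonpos_iff_eq_zero, smul_eq_mul, mul_eq_zero] at h0
  rw [Filter.eventuallyConst_set']
  exact h0.imp ae_eq_empty.2 ae_eq_univ.2

lemma LocHolder.aemeasurable {f : ℝ → ℝ} (hf : LocHolder f) {μ : Measure ℝ}
    (hμX : ∀ᵐ x ∂μ, x ∈ gaussSet) : AEMeasurable f μ := by
  obtain ⟨C, hC, θ, hθ, h⟩ := hf.exists_cfWord_bound
  have hy := branchFixedPoint_mem one_pos
  set y := branchFixedPoint 1
  refine aemeasurable_of_tendsto_metrizable_ae atTop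
    (f := fun n x => f (invBranch (cfWord n x) y)) (fun n => ?_) ?_
  · exact ((Measurable.of_discrete (f := fun l => f (invBranch l y))).comp
      (measurable_cfWord n)).aemeasurable
  · filter_upwards [hμX] with x hx
    rw [tendsto_iff_dist_tendsto_zero]
    have h0 : Tendsto (fun n : ℕ => C * θ ^ n) atTop (𝓝 0) := by
      simpa using (tendsto_pow_atTop_nhds_zero_of_lt_one hθ.1.le hθ.2).const_mul C
    refine squeeze_zero' (.of_forall fun _ => dist_nonneg) ?_ h0
    filter_upwards [eventually_gt_atTop 0] with n hn
    refine h n hn _ (invBranch_mem (cfWord_pos hx n) hy) x hx ?_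
    have := cfWord_invBranch (cfWord_pos hx n) hy
    rwa [length_cfWord] at this

/-- Finiteness of the first partition sum gives an exponential moment. -/
lemma lintegral_exp_lt_top {φ f : ℝ → ℝ} {μ : Measure ℝ} (hμX : ∀ᵐ x ∂μ, x ∈ gaussSet)
    [IsFiniteMeasure μ] (hG : IsGibbs φ μ) (hf : LocHolder f) {t : ℝ}
    (ht : partSum (fun x => t * f x + φ x) 1 ≠ ⊤) :
    ∫⁻ x, ENNReal.ofReal (Real.exp (t * f x)) ∂μ < ⊤ := by
  obtain ⟨C, hC, hG⟩ := hG
  obtain ⟨K, hK, hdist⟩ := hf.exists_birkhoff_bound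
  set G : ℕ → ℝ≥0∞ := fun a =>
    ENNReal.ofReal (Real.exp (|t| * K)) * ENNReal.ofReal (Real.exp (t * f (branchFixedPoint a)))
  have hle : ∫⁻ x, ENNReal.ofReal (Real.exp (t * f x)) ∂μ ≤ ∫⁻ x, G (cfDigit1 x) ∂μ := by
    refine lintegral_mono_ae ?_
    filter_upwards [hμX] with x hx
    have hp := branchFixedPoint_mem (cfDigit1_pos hx)
    have hd : cfDigit1 (branchFixedPoint (cfDigit1 x)) = cfDigit1 x := by
      conv_lhs => rw [← invBranch1_branchFixedPoint, cfDigit1_invBranch1 _ hp]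
    have h1 := hdist 1 x hx _ hp (by simp [cfWord, hd])
    simp only [birkhoff, Finset.range_one, Finset.sum_singleton, Function.iterate_zero, id] at h1
    simp only [G]
    rw [← ENNReal.ofReal_mul (Real.exp_pos _).le, ← Real.exp_add]
    refine ENNReal.ofReal_le_ofReal (Real.exp_le_exp.2 ?_)
    have h2 : t * (f x - f (branchFixedPoint (cfDigit1 x))) ≤ |t| * K := by
      refine (le_abs_self _).trans ?_
      rw [abs_mul]
      gcongr
    linarith
  refine hle.trans_lt ?_
  rw [← lintegral_map (g := cfDigit1) (f := G) .of_discrete measurable_cfDigit1,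
    lintegral_countable', tsum_eq_zero_add' ENNReal.summable]
  have hmap : ∀ a, (μ.map cfDigit1) {a} = μ (cfDigit1 ⁻¹' {a}) := fun a =>
    Measure.map_apply measurable_cfDigit1 .of_discrete
  have h0 : (μ.map cfDigit1) {0} = 0 := by
    rw [hmap, measure_eq_zero_iff_ae_notMem]
    filter_upwards [hμX] with x hx using (cfDigit1_pos hx).ne'
  rw [h0, mul_zero, zero_add]
  set F : Word 1 → ℝ≥0∞ := fun l => ENNReal.ofReal (Real.exp
    (birkhoff (fun x => t * f x + φ x) 1 (periodicPoint l.1)))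
  set w : ℕ → Word 1 := fun a => ⟨[a + 1], by simp⟩
  have hw : Function.Injective w := fun a b hab => by
    simpa [w] using congrArg Subtype.val hab
  have hterm : ∀ a, G (a + 1) * (μ.map cfDigit1) {a + 1} ≤
      ENNReal.ofReal (Real.exp (|t| * K)) * ENNReal.ofReal C * F (w a) := by
    intro a
    have hp := branchFixedPoint_mem a.succ_pos
    have hcyl : (μ.map cfDigit1) {a + 1} = μ (cylinder [a + 1]) := by
      rw [hmap]
      refine measure_congr ?_
      filter_upwards [hμX] with x hx
      refine propext ?_
      change cfDigit1 x = a + 1 ↔ x ∈ cylinder [a + 1]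
      rw [mem_cylinder_iff]
      simp [hx, cfWord]
    have h2 := (hG [a + 1] (by simp) (by simp) _ hp).2
    have e : invBranch [a + 1] (branchFixedPoint (a + 1)) = branchFixedPoint (a + 1) :=
      invBranch1_branchFixedPoint _
    rw [Nat.succ_eq_add_one, e] at h2
    simp only [List.length_singleton, birkhoff, Finset.range_one, Finset.sum_singleton,
      Function.iterate_zero, id] at h2
    have h3 : μ (cylinder [a + 1]) ≤
        ENNReal.ofReal (C * Real.exp (φ (branchFixedPoint (a + 1)))) :=
      (ENNReal.le_ofReal_iff_toReal_le (measure_ne_top μ _) (by positivity)).2 h2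
    have hF : F (w a) = ENNReal.ofReal (Real.exp (t * f (branchFixedPoint (a + 1)) +
        φ (branchFixedPoint (a + 1)))) := by
      simp only [F, w, periodicPoint_singleton a.succ_pos, birkhoff, Finset.range_one,
        Finset.sum_singleton, Function.iterate_zero, id, Nat.succ_eq_add_one]
    rw [hcyl, hF, Real.exp_add, ENNReal.ofReal_mul (Real.exp_pos _).le]
    rw [ENNReal.ofReal_mul (by linarith)] at h3
    calc _ ≤ _ := mul_le_mul_right h3 _
      _ = _ := by simp only [G]; ring
  refine (ENNReal.tsum_le_tsum hterm).trans_lt ?_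
  rw [ENNReal.tsum_mul_left]
  refine ENNReal.mul_lt_top (by finiteness) ?_
  exact (ENNReal.tsum_comp_le_tsum_of_injective hw F).trans_lt ht.lt_top

end

noncomputable section

/-- Convergence in probability of Birkhoff averages for a centred square-integrable function. -/
lemma Ergodic.tendsto_measure_birkhoff {μ : Measure ℝ} [IsProbabilityMeasure μ]
    (hT : Ergodic gaussMap μ) {f : ℝ → ℝ} (hf : MemLp f 2 μ) (h0 : ∫ x, f x ∂μ = 0)
    {η : ℝ} (hη : 0 < η) :
    Tendsto (fun n : ℕ => μ {x | η * n ≤ |birkhoff f n x|}) atTop (𝓝 0) := by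
  have hmp := hT.toMeasurePreserving
  set U : Lp ℝ 2 μ →ₗᵢ[ℝ] Lp ℝ 2 μ := Lp.compMeasurePreservingₗᵢ ℝ gaussMap hmp with hU
  set F : Lp ℝ 2 μ := hf.toLp f with hF
  have hcomp : ∀ k, MemLp (f ∘ gaussMap^[k]) 2 μ := fun k =>
    hf.comp_measurePreserving (hmp.iterate k)
  have hUk : ∀ k, U.toContinuousLinearMap^[k] F = (hcomp k).toLp _ := by
    intro k
    induction k with
    | zero => rfl
    | succ k ih =>
      rw [Function.iterate_succ_apply', ih]
      exact Lp.toLp_compMeasurePreserving (hcomp k) hmp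
  set S : ℕ → Lp ℝ 2 μ := fun n => birkhoffSum U.toContinuousLinearMap _root_.id n F with hS
  have hsum : ∀ n, S n =ᵐ[μ] birkhoff f n := by
    intro n
    induction n with
    | zero =>
      simp only [hS, birkhoffSum_zero]
      exact Lp.coeFn_zero _ _ _
    | succ n ih =>
      have e : S (n + 1) = S n + (hcomp n).toLp _ := by
        rw [← hUk]
        exact birkhoffSum_succ _ _ _ _
      rw [e]
      filter_upwards [ih, Lp.coeFn_add (S n) ((hcomp n).toLp _), (hcomp n).coeFn_toLp]
        with x h1 h2 h3
      rw [h2, Pi.add_apply, h1, h3]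
      simp [birkhoff, Finset.sum_range_succ]
  set A : ℕ → Lp ℝ 2 μ := fun n => birkhoffAverage ℝ U.toContinuousLinearMap _root_.id n F with hA
  have havg : ∀ n, A n =ᵐ[μ] fun x => (n : ℝ)⁻¹ * birkhoff f n x := by
    intro n
    filter_upwards [hsum n, Lp.coeFn_smul ((n : ℝ)⁻¹) (S n)] with x h1 h2
    change (((n : ℝ)⁻¹ • S n : Lp ℝ 2 μ) : ℝ → ℝ) x = _
    rw [h2, Pi.smul_apply, h1, smul_eq_mul]
  have hf_int : ∀ n, ∫ x, birkhoff f n x ∂μ = 0 := by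
    intro n
    have hadd := integral_finsetSum (μ := μ) (Finset.range n)
      (f := fun k x => f (gaussMap^[k] x)) fun k _ => (hcomp k).integrable (by norm_num)
    refine hadd.trans ?_
    refine Finset.sum_eq_zero fun k _ => ?_
    have hk := hmp.iterate k
    have := integral_map (f := f) hk.aemeasurable (by rw [hk.map_eq]; exact hf.1)
    rw [hk.map_eq, h0] at this
    exact this.symm
  have hlim := U.toContinuousLinearMap.tendsto_birkhoffAverage_orthogonalProjection
    U.norm_toContinuousLinearMap_le F
  set P := (U.toContinuousLinearMap.eqLocus
    (1 : Lp ℝ 2 μ →L[ℝ] Lp ℝ 2 μ)).orthogonalProjectionOnto F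
  have hfix : U (P : Lp ℝ 2 μ) = P := P.2
  obtain ⟨c, hc⟩ : ∃ c, (P : Lp ℝ 2 μ) =ᵐ[μ] Function.const ℝ c := by
    refine hT.ae_eq_const_of_ae_eq_comp_ae (Lp.aestronglyMeasurable _) ?_
    have := Lp.coeFn_compMeasurePreserving (P : Lp ℝ 2 μ) hmp
    refine this.symm.trans ?_
    exact .of_eq (congrArg (fun G : Lp ℝ 2 μ => (G : ℝ → ℝ)) hfix)
  have hinner : ∀ G : Lp ℝ 2 μ,
      inner ℝ (indicatorConstLp 2 MeasurableSet.univ (measure_ne_top μ univ) (1 : ℝ)) G =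
        ∫ x, G x ∂μ := fun G => by
    rw [L2.inner_indicatorConstLp_one, setIntegral_univ]
  have hc0 : c = 0 := by
    have h1 := (tendsto_const_nhds (x := indicatorConstLp 2 MeasurableSet.univ
      (measure_ne_top μ univ) (1 : ℝ))).inner (𝕜 := ℝ) hlim
    have h2 : ∀ n, ∫ x, A n x ∂μ = 0 := fun n => by
      rw [integral_congr_ae (havg n), integral_const_mul, hf_int, mul_zero]
    have h3 : ∫ x, (P : Lp ℝ 2 μ) x ∂μ = c := by
      rw [integral_congr_ae hc]
      simp
    rw [hinner, h3] at h1
    refine tendsto_nhds_unique h1 (tendsto_const_nhds.congr fun n => ?_)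
    rw [hinner]
    exact (h2 n).symm
  have hmeas := tendstoInMeasure_of_tendsto_Lp hlim (ENNReal.ofReal η) (ENNReal.ofReal_pos.2 hη)
  refine hmeas.congr' ?_
  filter_upwards [eventually_gt_atTop 0] with n hn
  have hn' : (0 : ℝ) < n := by exact_mod_cast hn
  refine measure_congr ?_
  filter_upwards [havg n, hc] with x h1 h2
  refine propext ?_
  change ENNReal.ofReal η ≤ edist (A n x) ((P : Lp ℝ 2 μ) x) ↔ η * n ≤ |birkhoff f n x|
  rw [h1, h2, hc0, edist_dist, ENNReal.ofReal_le_ofReal_iff dist_nonneg, Function.const_apply,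
    Real.dist_eq, sub_zero, abs_mul, abs_of_pos (inv_pos.2 hn'), inv_mul_eq_div, le_div_iff₀ hn']

end

noncomputable section

/-- The Birkhoff sum of `f` at a reference point of the cylinder of the word `l`. -/
def cfSum (f : ℝ → ℝ) (l : List ℕ) : ℝ :=
  birkhoff f l.length (invBranch l (branchFixedPoint 1))

/-- The discretized exponential moment of the Birkhoff sums of `f`. -/
def expMoment (μ : Measure ℝ) (f : ℝ → ℝ) (t : ℝ) (n : ℕ) : ℝ≥0∞ :=
  ∫⁻ x, ENNReal.ofReal (Real.exp (t * cfSum f (cfWord n x))) ∂μ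

/-- `K` bounds the distortion of the Birkhoff sums of `f`. -/
def BirkhoffBound (f : ℝ → ℝ) (K : ℝ) : Prop :=
  ∀ n, ∀ x ∈ gaussSet, ∀ y ∈ gaussSet,
    cfWord n x = cfWord n y → |birkhoff f n x - birkhoff f n y| ≤ K

section

variable {f : ℝ → ℝ} {K t : ℝ} {D : ℝ≥0} {μ : Measure ℝ}

lemma measurable_exp_cfSum (f : ℝ → ℝ) (t : ℝ) (n : ℕ) :
    Measurable fun x => ENNReal.ofReal (Real.exp (t * cfSum f (cfWord n x))) :=
  (Measurable.of_discrete (f := fun l => ENNReal.ofReal (Real.exp (t * cfSum f l)))).comp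
    (measurable_cfWord n)

lemma BirkhoffBound.abs_cfSum_sub_le (hK : BirkhoffBound f K) {x : ℝ} (hx : x ∈ gaussSet) (n : ℕ) :
    |cfSum f (cfWord n x) - birkhoff f n x| ≤ K := by
  have hl := cfWord_pos hx n
  have hy := branchFixedPoint_mem one_pos
  have h1 := cfWord_invBranch hl hy
  unfold cfSum
  rw [length_cfWord] at h1 ⊢
  exact hK n _ (invBranch_mem hl hy) x hx h1

lemma BirkhoffBound.cfSum_append_le (hK : BirkhoffBound f K) {l l' : List ℕ}
    (hl : ∀ a ∈ l, 0 < a) (hl' : ∀ a ∈ l', 0 < a) :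
    cfSum f (l ++ l') ≤ K + cfSum f l + cfSum f l' := by
  have hy := branchFixedPoint_mem one_pos
  have hy' := invBranch_mem hl' hy
  unfold cfSum
  rw [List.length_append, birkhoff_add, invBranch_append, iterate_invBranch hl hy']
  have := hK l.length _ (invBranch_mem hl hy') _ (invBranch_mem hl hy)
    (by rw [cfWord_invBranch hl hy', cfWord_invBranch hl hy])
  linarith [le_abs_self (birkhoff f l.length (invBranch l (invBranch l' (branchFixedPoint 1))) -
    birkhoff f l.length (invBranch l (branchFixedPoint 1)))]

lemma expMoment_zero [IsProbabilityMeasure μ] : expMoment μ f t 0 = 1 := by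
  simp [expMoment, cfWord, cfSum, birkhoff]

/-- The joint law of two consecutive words is dominated by the product of their laws. -/
lemma QuasiBernoulli.map_le_prod [IsProbabilityMeasure μ] (hμX : μ gaussSetᶜ = 0)
    (h : QuasiBernoulli D μ) (m n : ℕ) :
    μ.map (fun x => (cfWord m x, cfWord n (gaussMap^[m] x))) ≤
      D • (μ.map (cfWord m)).prod (μ.map (cfWord n)) := by
  have hm : Measurable fun x => (cfWord m x, cfWord n (gaussMap^[m] x)) :=
    (measurable_cfWord m).prodMk ((measurable_cfWord n).comp (measurable_gaussMap.iterate m))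
  refine measure_le_of_singleton_le fun p => ?_
  obtain ⟨l, l'⟩ := p
  rw [Measure.smul_apply, ← singleton_prod_singleton, Measure.prod_prod,
    Measure.map_apply hm .of_discrete, Measure.map_apply (measurable_cfWord m) .of_discrete,
    Measure.map_apply (measurable_cfWord n) .of_discrete]
  set s := (fun x => (cfWord m x, cfWord n (gaussMap^[m] x))) ⁻¹' ({l} ×ˢ {l'})
  rcases (s ∩ gaussSet).eq_empty_or_nonempty with h0 | ⟨x, ⟨hx, hx'⟩, hxX⟩
  · rw [measure_mono_null (fun y hy hyX => (h0 ▸ ⟨hy, hyX⟩ : y ∈ (∅ : Set ℝ))) hμX]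
    exact zero_le
  · have hx : cfWord m x = l := hx
    have hx' : cfWord n (gaussMap^[m] x) = l' := hx'
    have hl : l.length = m := hx ▸ length_cfWord m x
    have hl' : l'.length = n := hx' ▸ length_cfWord _ _
    have e : s ∩ gaussSet = cylinder (l ++ l') := by
      ext y
      rw [cylinder_append, mem_inter_iff, mem_inter_iff, mem_preimage, mem_preimage,
        mem_cylinder_iff, mem_cylinder_iff, hl, hl']
      constructor
      · rintro ⟨⟨h1, h2⟩, hy⟩
        exact ⟨⟨hy, h1⟩, gaussMap_iterate_mem hy m, h2⟩
      · rintro ⟨⟨hy, h1⟩, -, h2⟩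
        exact ⟨⟨h1, h2⟩, hy⟩
    have h1 := measure_cfWord_preimage hμX l
    have h2 := measure_cfWord_preimage hμX l'
    rw [hl] at h1
    rw [hl'] at h2
    rw [h1, h2, ← measure_inter_conull' (measure_mono_null (fun y hy => hy.2) hμX :
      μ (s \ gaussSet) = 0), e]
    exact (h l l' (hx ▸ cfWord_pos hxX m)
      (hx' ▸ cfWord_pos (gaussMap_iterate_mem hxX m) n)).1

lemma QuasiBernoulli.expMoment_add_le [IsProbabilityMeasure μ] (hμX : μ gaussSetᶜ = 0)
    (h : QuasiBernoulli D μ) (hK : BirkhoffBound f K) (ht : 0 ≤ t) (m n : ℕ) :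
    expMoment μ f t (m + n) ≤
      ENNReal.ofReal (Real.exp (t * K)) * D * expMoment μ f t m * expMoment μ f t n := by
  have hm : Measurable fun x => (cfWord m x, cfWord n (gaussMap^[m] x)) :=
    (measurable_cfWord m).prodMk ((measurable_cfWord n).comp (measurable_gaussMap.iterate m))
  set g : List ℕ → ℝ≥0∞ := fun l => ENNReal.ofReal (Real.exp (t * cfSum f l)) with hg
  have hmg : ∀ k, ∫⁻ l, g l ∂(μ.map (cfWord k)) = expMoment μ f t k := fun k =>
    lintegral_map .of_discrete (measurable_cfWord k)
  have hX : ∀ᵐ x ∂μ, x ∈ gaussSet := hμX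
  calc expMoment μ f t (m + n)
      ≤ ∫⁻ x, ENNReal.ofReal (Real.exp (t * K)) *
          (g (cfWord m x) * g (cfWord n (gaussMap^[m] x))) ∂μ := by
        refine lintegral_mono_ae ?_
        filter_upwards [hX] with x hx
        rw [cfWord_add]
        simp only [hg]
        rw [← ENNReal.ofReal_mul (Real.exp_pos _).le, ← ENNReal.ofReal_mul (Real.exp_pos _).le,
          ← Real.exp_add, ← Real.exp_add]
        refine ENNReal.ofReal_le_ofReal (Real.exp_le_exp.2 ?_)
        have := mul_le_mul_of_nonneg_left (hK.cfSum_append_le (cfWord_pos hx m)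
          (cfWord_pos (gaussMap_iterate_mem hx m) n)) ht
        linarith
    _ = ENNReal.ofReal (Real.exp (t * K)) * ∫⁻ p, g p.1 * g p.2
          ∂(μ.map (fun x => (cfWord m x, cfWord n (gaussMap^[m] x)))) := by
        rw [lintegral_const_mul' _ _ ENNReal.ofReal_ne_top, lintegral_map .of_discrete hm]
    _ ≤ ENNReal.ofReal (Real.exp (t * K)) * ∫⁻ p, g p.1 * g p.2
          ∂(D • (μ.map (cfWord m)).prod (μ.map (cfWord n))) := by
        gcongr
        exact h.map_le_prod hμX m n
    _ = _ := by
        have : ∫⁻ p, g p.1 * g p.2 ∂(D • (μ.map (cfWord m)).prod (μ.map (cfWord n))) =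
            D * ∫⁻ p, g p.1 * g p.2 ∂((μ.map (cfWord m)).prod (μ.map (cfWord n))) :=
          lintegral_smul_measure (D : ℝ≥0∞) _
        rw [this, lintegral_prod_mul .of_discrete .of_discrete, hmg, hmg]
        ring

lemma QuasiBernoulli.expMoment_mul_add_le [IsProbabilityMeasure μ] (hμX : μ gaussSetᶜ = 0)
    (h : QuasiBernoulli D μ) (hK : BirkhoffBound f K) (ht : 0 ≤ t) (k N r : ℕ) :
    expMoment μ f t (k * N + r) ≤
      (ENNReal.ofReal (Real.exp (t * K)) * D * expMoment μ f t N) ^ k * expMoment μ f t r := by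
  induction k with
  | zero => simp
  | succ k ih =>
    have e : (k + 1) * N + r = N + (k * N + r) := by ring
    rw [e, pow_succ', mul_assoc]
    exact (h.expMoment_add_le hμX hK ht _ _).trans (by gcongr)

/-- Jensen's inequality for the exponential moments of Birkhoff averages. -/
lemma BirkhoffBound.expMoment_div_le [IsProbabilityMeasure μ] (hμX : μ gaussSetᶜ = 0)
    (hinv : GaussInvariant μ) (hK : BirkhoffBound f K) (hf : AEMeasurable f μ) {u t₁ : ℝ}
    (hu : 0 ≤ u) (hut : u ≤ t₁) {N : ℕ} (hN : 0 < N) :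
    expMoment μ f (u / N) N ≤ ENNReal.ofReal (Real.exp (u / N * K)) *
      (1 + ∫⁻ x, ENNReal.ofReal (Real.exp (t₁ * f x)) ∂μ) := by
  have hX : ∀ᵐ x ∂μ, x ∈ gaussSet := hμX
  have hN' : (0 : ℝ) < N := by exact_mod_cast hN
  set g : ℝ → ℝ≥0∞ := fun x => 1 + ENNReal.ofReal (Real.exp (t₁ * f x)) with hg
  have hgm : AEMeasurable g μ :=
    ((hf.const_mul t₁).exp.ennreal_ofReal).const_add 1
  have hgk : ∀ k, ∫⁻ x, g (gaussMap^[k] x) ∂μ = ∫⁻ x, g x ∂μ := fun k => by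
    have hk := hinv.measurePreserving.iterate k
    have := lintegral_map' (μ := μ) (f := g) (by rw [hk.map_eq]; exact hgm) hk.aemeasurable
    rw [hk.map_eq] at this
    exact this.symm
  have hgkm : ∀ k, AEMeasurable (fun x => g (gaussMap^[k] x)) μ := fun k =>
    hgm.comp_quasiMeasurePreserving
      (hinv.measurePreserving.iterate k).quasiMeasurePreserving
  have hpt : ∀ x ∈ gaussSet, ENNReal.ofReal (Real.exp (u / N * cfSum f (cfWord N x))) ≤
      ENNReal.ofReal (Real.exp (u / N * K)) * (ENNReal.ofReal (N : ℝ)⁻¹ *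
        ∑ k ∈ Finset.range N, g (gaussMap^[k] x)) := by
    intro x hx
    have h1 : Real.exp (u / N * cfSum f (cfWord N x)) ≤
        Real.exp (u / N * K) * Real.exp (u / N * birkhoff f N x) := by
      rw [← Real.exp_add, Real.exp_le_exp, ← mul_add]
      refine mul_le_mul_of_nonneg_left ?_ (by positivity)
      linarith [(abs_le.1 (hK.abs_cfSum_sub_le hx N)).2]
    have h2 : Real.exp (u / N * birkhoff f N x) ≤
        (N : ℝ)⁻¹ * ∑ k ∈ Finset.range N, Real.exp (u * f (gaussMap^[k] x)) := by
      have := convexOn_exp.map_sum_le (t := Finset.range N) (w := fun _ => (N : ℝ)⁻¹)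
        (p := fun k => u * f (gaussMap^[k] x)) (fun _ _ => by positivity)
        (by simp [hN'.ne']) (fun _ _ => mem_univ _)
      simp only [smul_eq_mul, ← Finset.mul_sum] at this
      refine le_trans (le_of_eq ?_) this
      simp only [birkhoff]
      congr 1
      ring
    have h3 : ∀ z : ℝ, Real.exp (u * z) ≤ 1 + Real.exp (t₁ * z) := by
      intro z
      rcases le_total 0 z with hz | hz
      · have := Real.exp_le_exp.2 (mul_le_mul_of_nonneg_right hut hz)
        linarith
      · have := Real.exp_le_one_iff.2 (mul_nonpos_of_nonneg_of_nonpos hu hz)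
        linarith [Real.exp_pos (t₁ * z)]
    have h4 : ∀ k, g (gaussMap^[k] x) =
        ENNReal.ofReal (1 + Real.exp (t₁ * f (gaussMap^[k] x))) := fun k => by
      rw [ENNReal.ofReal_add zero_le_one (Real.exp_pos _).le, ENNReal.ofReal_one]
    simp only [h4]
    rw [← ENNReal.ofReal_sum_of_nonneg (fun k _ => by positivity),
      ← ENNReal.ofReal_mul (by positivity), ← ENNReal.ofReal_mul (by positivity)]
    refine ENNReal.ofReal_le_ofReal (h1.trans ?_)
    gcongr
    refine h2.trans ?_
    gcongr with k
    exact h3 _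
  have hsum : ∫⁻ x, g x ∂μ = 1 + ∫⁻ x, ENNReal.ofReal (Real.exp (t₁ * f x)) ∂μ := by
    rw [lintegral_add_left measurable_const]
    simp
  calc expMoment μ f (u / N) N
      ≤ ∫⁻ x, ENNReal.ofReal (Real.exp (u / N * K)) * (ENNReal.ofReal (N : ℝ)⁻¹ *
        ∑ k ∈ Finset.range N, g (gaussMap^[k] x)) ∂μ :=
        lintegral_mono_ae (hX.mono hpt)
    _ = ENNReal.ofReal (Real.exp (u / N * K)) * (ENNReal.ofReal (N : ℝ)⁻¹ *
          (N * ∫⁻ x, g x ∂μ)) := by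
        rw [lintegral_const_mul' _ _ ENNReal.ofReal_ne_top,
          lintegral_const_mul' _ _ ENNReal.ofReal_ne_top,
          lintegral_finsetSum' _ fun k _ => hgkm k]
        simp [hgk]
    _ = _ := by
        rw [← hsum, ← mul_assoc (ENNReal.ofReal (N : ℝ)⁻¹), ENNReal.ofReal_inv_of_pos hN',
          ENNReal.ofReal_natCast, ENNReal.inv_mul_cancel (by simpa using hN.ne') (by simp), one_mul]

end
end

noncomputable section

/-- Some exponential moment, at small parameter, grows slowly enough to beat the constants lost
in the submultiplicativity of the moments. -/
lemma QuasiBernoulli.exists_expMoment_le {f : ℝ → ℝ} {K : ℝ} {D : ℝ≥0} {μ : Measure ℝ}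
    [IsProbabilityMeasure μ] (hμX : μ gaussSetᶜ = 0) (hinv : GaussInvariant μ) (hD : 1 ≤ D)
    (h : QuasiBernoulli D μ) (hK : BirkhoffBound f K) (hK0 : 0 < K) (hf : AEMeasurable f μ)
    (hf2 : MemLp f 2 μ) (h0 : ∫ x, f x ∂μ = 0) {t₁ : ℝ} (ht₁ : 0 < t₁)
    (hexp : ∫⁻ x, ENNReal.ofReal (Real.exp (t₁ * f x)) ∂μ < ⊤) {ε : ℝ} (hε : 0 < ε) :
    ∃ N : ℕ, 0 < N ∧ ∃ t : ℝ, 0 < t ∧ t ≤ t₁ ∧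
      ENNReal.ofReal (Real.exp (t * K)) * D * expMoment μ f t N ≤
        ENNReal.ofReal (Real.exp (t * (N * (ε / 2)))) := by
  have hX : ∀ᵐ x ∂μ, x ∈ gaussSet := hμX
  have hD1 : (1 : ℝ) ≤ D := by exact_mod_cast hD
  obtain ⟨s, hs0, hs⟩ : ∃ s : ℝ, 0 < s ∧ Real.exp K * D * 3 ≤ Real.exp (s * (ε / 4)) := by
    have h1 : 1 < Real.exp K * D * 3 := by
      have := Real.one_lt_exp_iff.2 hK0
      nlinarith
    refine ⟨Real.log (Real.exp K * D * 3) / (ε / 4), div_pos (Real.log_pos h1) (by linarith), ?_⟩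
    rw [div_mul_cancel₀ _ (by linarith), Real.exp_log (by linarith)]
  obtain ⟨p, hp⟩ := exists_nat_gt (2 * s / min t₁ 1)
  have hm : 0 < min t₁ 1 := lt_min ht₁ one_pos
  have hp0 : (0 : ℝ) < p := lt_trans (by positivity) hp
  have hp1 : 0 < p := by exact_mod_cast hp0
  set u := 2 * s / p with hu
  have hu0 : 0 < u := by positivity
  have hum : u ≤ min t₁ 1 := by
    rw [hu, div_le_iff₀ hp0]
    linarith [(div_lt_iff₀ hm).1 hp]
  set I := ∫⁻ x, ENNReal.ofReal (Real.exp (t₁ * f x)) ∂μ with hI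
  set B : ℝ≥0∞ := (ENNReal.ofReal (Real.exp K) * D * (ENNReal.ofReal (Real.exp K) * (1 + I))) ^ p
    with hB
  have hBtop : B ≠ ⊤ := by
    have := hexp.ne
    finiteness
  have hB1 : 1 ≤ B := by
    have hK1 : 1 ≤ ENNReal.ofReal (Real.exp K) :=
      ENNReal.one_le_ofReal.2 (Real.one_le_exp_iff.2 hK0.le)
    have hD' : (1 : ℝ≥0∞) ≤ D := by exact_mod_cast hD
    exact one_le_pow₀ (one_le_mul (one_le_mul hK1 hD') (one_le_mul hK1 le_self_add))
  -- choose the block length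
  have hlim := (h.ergodic hμX hinv).tendsto_measure_birkhoff hf2 h0
    (show 0 < ε / 8 by linarith)
  have hlim' := ENNReal.Tendsto.const_mul (a := B) hlim (Or.inr hBtop)
  rw [mul_zero] at hlim'
  have hpM : Tendsto (fun M : ℕ => p * M) atTop atTop :=
    tendsto_id.const_mul_atTop' hp1
  have ev1 := hpM.eventually (hlim'.eventually (ge_mem_nhds one_pos))
  have ev2 := hpM.eventually
    (tendsto_natCast_atTop_atTop.eventually_ge_atTop (K / (ε / 8)))
  obtain ⟨M, hM1, hM2, hM0⟩ := (ev1.and (ev2.and (eventually_gt_atTop 0))).exists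
  have hMr : (1 : ℝ) ≤ M := by exact_mod_cast hM0
  set N := p * M with hN
  have hN0 : 0 < N := Nat.mul_pos hp1 hM0
  have hNr : (0 : ℝ) < N := by exact_mod_cast hN0
  set t := s / N with ht
  have ht0 : 0 < t := by positivity
  have htN : t * N = s := div_mul_cancel₀ _ hNr.ne'
  have h2t : 2 * t = u / M := by
    rw [ht, hu, hN]
    push_cast
    field_simp
  have huM : u / M ≤ u := div_le_self hu0.le hMr
  have ht1 : t ≤ min t₁ 1 := by linarith
  rw [div_le_iff₀ (by linarith)] at hM2
  -- the moment at parameter `2 * t` is bounded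
  have hE2 : expMoment μ f (2 * t) N ≤ B := by
    have hexpK : ENNReal.ofReal (Real.exp (2 * t * K)) ≤ ENNReal.ofReal (Real.exp K) := by
      refine ENNReal.ofReal_le_ofReal (Real.exp_le_exp.2 ?_)
      have : 2 * t ≤ 1 := by linarith [min_le_right t₁ 1]
      nlinarith
    have h1 := h.expMoment_mul_add_le hμX hK (by positivity : 0 ≤ 2 * t) p M 0
    rw [expMoment_zero, mul_one, add_zero] at h1
    refine h1.trans ?_
    have h2 := hK.expMoment_div_le hμX hinv hf hu0.le (hum.trans (min_le_left _ _)) hM0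
    rw [← h2t] at h2
    rw [hB]
    gcongr
    refine h2.trans ?_
    gcongr
  set bad : Set ℝ := {x | ε / 8 * N ≤ |birkhoff f N x|} with hbad
  set g : ℝ → ℝ≥0∞ := fun x => ENNReal.ofReal (Real.exp (2 * t * cfSum f (cfWord N x))) with hg
  have hpt : ∀ x ∈ gaussSet, ENNReal.ofReal (Real.exp (t * cfSum f (cfWord N x))) ≤
      (ENNReal.ofReal (Real.exp (s * (ε / 4))) + B⁻¹ * g x) +
        bad.indicator (fun _ => B) x := by
    intro x hx
    by_cases hxb : x ∈ bad
    · rw [indicator_of_mem hxb]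
      set e := ENNReal.ofReal (Real.exp (t * cfSum f (cfWord N x))) with he
      have hge : g x = e * e := by
        simp only [hg, he]
        rw [← ENNReal.ofReal_mul (Real.exp_pos _).le, ← Real.exp_add]
        congr 2
        ring
      rcases le_total e B with hle | hle
      · exact hle.trans le_add_self
      · refine le_trans ?_ le_self_add
        refine le_trans ?_ le_add_self
        rw [hge, ← mul_assoc]
        refine le_mul_of_one_le_left' ?_
        rw [← ENNReal.inv_mul_cancel (zero_lt_one.trans_le hB1).ne' hBtop]
        gcongr
    · rw [indicator_of_notMem hxb, add_zero]
      refine le_trans ?_ le_self_add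
      refine ENNReal.ofReal_le_ofReal (Real.exp_le_exp.2 ?_)
      have h1 : |birkhoff f N x| < ε / 8 * N := not_le.1 hxb
      have h2 := (abs_le.1 (hK.abs_cfSum_sub_le hx N)).2
      have h3 : cfSum f (cfWord N x) ≤ N * (ε / 4) := by
        have := (abs_lt.1 h1).2
        have hM3 : K ≤ N * (ε / 8) := hM2
        linarith
      calc t * cfSum f (cfWord N x) ≤ t * (N * (ε / 4)) := by gcongr
        _ = s * (ε / 4) := by rw [← mul_assoc, htN]
  have hE : expMoment μ f t N ≤ ENNReal.ofReal (Real.exp (s * (ε / 4))) * 3 := by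
    have hone : 1 ≤ ENNReal.ofReal (Real.exp (s * (ε / 4))) :=
      ENNReal.one_le_ofReal.2 (Real.one_le_exp_iff.2 (by positivity))
    calc expMoment μ f t N
        ≤ ∫⁻ x, ((ENNReal.ofReal (Real.exp (s * (ε / 4))) + B⁻¹ * g x) +
          bad.indicator (fun _ => B) x) ∂μ := lintegral_mono_ae (hX.mono hpt)
      _ = ENNReal.ofReal (Real.exp (s * (ε / 4))) + B⁻¹ * expMoment μ f (2 * t) N +
          ∫⁻ x, bad.indicator (fun _ => B) x ∂μ := by
        have hgm : Measurable g := measurable_exp_cfSum f (2 * t) N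
        have hsum : Measurable fun x => ENNReal.ofReal (Real.exp (s * (ε / 4))) + B⁻¹ * g x :=
          measurable_const.add (hgm.const_mul _)
        rw [lintegral_add_left hsum,
          lintegral_add_left measurable_const, lintegral_const_mul _ hgm]
        simp [expMoment, hg]
      _ ≤ ENNReal.ofReal (Real.exp (s * (ε / 4))) + 1 + 1 := by
        gcongr
        · calc B⁻¹ * expMoment μ f (2 * t) N ≤ B⁻¹ * B := by gcongr
            _ ≤ 1 := ENNReal.inv_mul_le_one B
        · exact (lintegral_indicator_const_le _ _).trans hM1
      _ ≤ ENNReal.ofReal (Real.exp (s * (ε / 4))) + ENNReal.ofReal (Real.exp (s * (ε / 4))) +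
          ENNReal.ofReal (Real.exp (s * (ε / 4))) := by gcongr
      _ = _ := by ring
  refine ⟨N, hN0, t, ht0, ht1.trans (min_le_left _ _), ?_⟩
  have hexpK : Real.exp (t * K) ≤ Real.exp K := by
    refine Real.exp_le_exp.2 ?_
    have : t ≤ 1 := ht1.trans (min_le_right _ _)
    nlinarith
  calc ENNReal.ofReal (Real.exp (t * K)) * D * expMoment μ f t N
      ≤ ENNReal.ofReal (Real.exp K) * D * (ENNReal.ofReal (Real.exp (s * (ε / 4))) * 3) := by
        gcongr
    _ = ENNReal.ofReal ((Real.exp K * D * 3) * Real.exp (s * (ε / 4))) := by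
        rw [ENNReal.ofReal_mul (by positivity), ENNReal.ofReal_mul (by positivity),
          ENNReal.ofReal_mul (by positivity), ENNReal.ofReal_coe_nnreal]
        norm_num
        ring
    _ ≤ ENNReal.ofReal (Real.exp (s * (ε / 4)) * Real.exp (s * (ε / 4))) := by
        gcongr
    _ = _ := by
        rw [← Real.exp_add, ← htN]
        congr 2
        ring

/-- One-sided large deviation bound for centred observables. -/
lemma QuasiBernoulli.exists_measure_lt_birkhoff_le {f : ℝ → ℝ} {D : ℝ≥0} {μ : Measure ℝ}
    [IsProbabilityMeasure μ] (hμX : μ gaussSetᶜ = 0) (hinv : GaussInvariant μ) (hD : 1 ≤ D)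
    (h : QuasiBernoulli D μ) (hfH : LocHolder f)
    (hf2 : MemLp f 2 μ) (h0 : ∫ x, f x ∂μ = 0) {t₁ : ℝ} (ht₁ : 0 < t₁)
    (hexp : ∫⁻ x, ENNReal.ofReal (Real.exp (t₁ * f x)) ∂μ < ⊤) {ε : ℝ} (hε : 0 < ε) :
    ∃ δ > (0 : ℝ), ∃ n₁ : ℕ, ∀ n : ℕ, n₁ ≤ n →
      μ {x | n * ε < birkhoff f n x} ≤ ENNReal.ofReal (Real.exp (-(n * δ)) / 2) := by
  have hX : ∀ᵐ x ∂μ, x ∈ gaussSet := hμX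
  have hf := hfH.aemeasurable hX
  obtain ⟨K, hK0, hK⟩ := hfH.exists_birkhoff_bound
  replace hK : BirkhoffBound f K := hK
  obtain ⟨N, hN, t, ht0, ht1, hNt⟩ :=
    h.exists_expMoment_le hμX hinv hD hK hK0 hf hf2 h0 ht₁ hexp hε
  have hfin : ∀ r, expMoment μ f t r ≠ ⊤ := by
    intro r
    have h1 := h.expMoment_mul_add_le hμX hK ht0.le r 1 0
    have h2 := hK.expMoment_div_le hμX hinv hf ht0.le ht1 one_pos
    rw [Nat.cast_one, div_one] at h2
    have h3 : expMoment μ f t 1 ≠ ⊤ := ne_top_of_le_ne_top (by finiteness) h2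
    rw [mul_one, add_zero, expMoment_zero, mul_one] at h1
    exact ne_top_of_le_ne_top (by finiteness) h1
  set R := (∑ r ∈ Finset.range N, expMoment μ f t r).toReal with hR
  have hRtop : ∑ r ∈ Finset.range N, expMoment μ f t r ≠ ⊤ :=
    ENNReal.sum_ne_top.2 fun r _ => hfin r
  have hEn : ∀ n, expMoment μ f t n ≤
      ENNReal.ofReal (Real.exp (t * (n * (ε / 2)))) * ENNReal.ofReal R := by
    intro n
    have h1 := h.expMoment_mul_add_le hμX hK ht0.le (n / N) N (n % N)
    rw [Nat.div_add_mod'] at h1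
    refine h1.trans (mul_le_mul' ?_ ?_)
    · refine (pow_le_pow_left' hNt _).trans ?_
      rw [← ENNReal.ofReal_pow (Real.exp_pos _).le, ← Real.exp_nat_mul]
      refine ENNReal.ofReal_le_ofReal (Real.exp_le_exp.2 ?_)
      have h2 : ((n / N : ℕ) : ℝ) * N ≤ n := by exact_mod_cast Nat.div_mul_le_self n N
      calc ((n / N : ℕ) : ℝ) * (t * (N * (ε / 2))) = (t * (ε / 2)) * ((n / N : ℕ) * N) := by ring
        _ ≤ (t * (ε / 2)) * n := by gcongr
        _ = _ := by ring
    · rw [hR, ENNReal.ofReal_toReal hRtop]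
      exact Finset.single_le_sum (f := fun r => expMoment μ f t r) (fun _ _ => zero_le)
        (Finset.mem_range.2 (Nat.mod_lt n hN))
  have hmarkov : ∀ n : ℕ, μ {x | n * ε < birkhoff f n x} ≤
      ENNReal.ofReal (Real.exp (-(t * (n * ε - K)))) * expMoment μ f t n := by
    intro n
    have h1 := mul_meas_ge_le_lintegral (μ := μ) (measurable_exp_cfSum f t n)
      (ENNReal.ofReal (Real.exp (t * (n * ε - K))))
    have h2 : μ {x | n * ε < birkhoff f n x} ≤ μ {x | ENNReal.ofReal (Real.exp (t * (n * ε - K))) ≤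
        ENNReal.ofReal (Real.exp (t * cfSum f (cfWord n x)))} := by
      refine measure_mono_ae ?_
      filter_upwards [hX] with x hx hxn
      refine ENNReal.ofReal_le_ofReal (Real.exp_le_exp.2 ?_)
      have := (abs_le.1 (hK.abs_cfSum_sub_le hx n)).1
      have hxn : n * ε < birkhoff f n x := hxn
      gcongr
      linarith
    calc μ {x | n * ε < birkhoff f n x}
        = ENNReal.ofReal (Real.exp (-(t * (n * ε - K)))) *
          (ENNReal.ofReal (Real.exp (t * (n * ε - K))) * μ {x | n * ε < birkhoff f n x}) := by
          rw [← mul_assoc, ← ENNReal.ofReal_mul (Real.exp_pos _).le, ← Real.exp_add]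
          simp
      _ ≤ _ := by
          gcongr
          exact (mul_le_mul_right h2 _).trans h1
  have hlim : Tendsto (fun n : ℕ => Real.exp (t * (ε / 4) * n)) atTop atTop :=
    Real.tendsto_exp_atTop.comp
      (tendsto_natCast_atTop_atTop.const_mul_atTop (by positivity))
  obtain ⟨n₁, hn₁⟩ := eventually_atTop.1 (hlim.eventually_ge_atTop (2 * (Real.exp (t * K) * R)))
  refine ⟨t * (ε / 4), by positivity, n₁, fun n hn => ?_⟩
  refine (hmarkov n).trans ((mul_le_mul_right (hEn n) _).trans ?_)
  rw [← ENNReal.ofReal_mul (Real.exp_pos _).le, ← ENNReal.ofReal_mul (Real.exp_pos _).le]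
  refine ENNReal.ofReal_le_ofReal ?_
  have e1 : Real.exp (-(t * (n * ε - K))) =
      Real.exp (t * K) * Real.exp (-(n * (t * (ε / 4)))) * Real.exp (-(t * (ε / 4) * n)) *
        Real.exp (-(t * (n * (ε / 2)))) := by
    rw [← Real.exp_add, ← Real.exp_add, ← Real.exp_add]
    congr 1
    ring
  have h3 : Real.exp (t * K) * R * Real.exp (-(t * (ε / 4) * n)) ≤ 1 / 2 := by
    rw [Real.exp_neg, ← div_eq_mul_inv, div_le_iff₀ (Real.exp_pos _)]
    linarith [hn₁ n hn]
  calc Real.exp (-(t * (n * ε - K))) * (Real.exp (t * (n * (ε / 2))) * R)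
      = Real.exp (-(n * (t * (ε / 4)))) * (Real.exp (t * K) * R * Real.exp (-(t * (ε / 4) * n))) *
        (Real.exp (-(t * (n * (ε / 2)))) * Real.exp (t * (n * (ε / 2)))) := by rw [e1]; ring
    _ = Real.exp (-(n * (t * (ε / 4)))) *
        (Real.exp (t * K) * R * Real.exp (-(t * (ε / 4) * n))) := by
        rw [← Real.exp_add, neg_add_cancel, Real.exp_zero, mul_one]
    _ ≤ Real.exp (-(n * (t * (ε / 4)))) * (1 / 2) := by gcongr
    _ = _ := by ring

end

/-- Large deviations for Gibbs measures of the Gauss map: if the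
pressure `P(tf+φ)` is finite for `t` in a neighbourhood of `0`, then for every `ε > 0`
there are `δ > 0` and `n₁` with
`μ_φ({x : |S_n f(x) - n α(f)| > nε}) ≤ e^{-nδ}` for all `n ≥ n₁`. -/
theorem gibbs_large_deviation
    (φ f : ℝ → ℝ) (μ : MeasureTheory.Measure ℝ) [MeasureTheory.IsProbabilityMeasure μ]
    (hμX : μ gaussSet = 1) (hinv : GaussInvariant μ)
    (hφH : LocHolder φ) (hφ0 : ∀ x ∈ gaussSet, φ x ≤ 0) (hP : HasPressure φ 0)
    (hGibbs : IsGibbs φ μ) (hfH : LocHolder f)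
    (hfin : ∃ t₀ > (0:ℝ), ∀ t : ℝ, |t| < t₀ → PressureFinite fun x => t * f x + φ x) :
    ∀ ε > (0:ℝ), ∃ δ > (0:ℝ), ∃ n₁ : ℕ, ∀ n : ℕ, n₁ ≤ n →
      (μ {x | (n : ℝ) * ε < |birkhoff f n x - (n : ℝ) * ∫ y, f y ∂μ|}).toReal
        ≤ Real.exp (-((n : ℝ) * δ)) := by
  intro ε hε
  have hμX' : μ gaussSetᶜ = 0 := (prob_compl_eq_zero_iff measurableSet_gaussSet).2 hμX
  have hX : ∀ᵐ x ∂μ, x ∈ gaussSet := hμX'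
  obtain ⟨D, hD, hB⟩ := hGibbs.exists_quasiBernoulli hμX
  obtain ⟨t₀, ht₀, hfin⟩ := hfin
  have hfm := hfH.aemeasurable hX
  have hmom : ∀ t, |t| < t₀ → ∫⁻ x, ENNReal.ofReal (Real.exp (t * f x)) ∂μ < ⊤ := by
    intro t ht
    obtain ⟨p, hp, -⟩ := hfin t ht
    exact lintegral_exp_lt_top hX hGibbs hfH (hp 1 one_pos)
  have hzero : (0 : ℝ) ∈ interior (ProbabilityTheory.integrableExpSet f μ) := by
    refine mem_interior.2 ⟨Metric.ball 0 t₀, fun t ht => ?_, Metric.isOpen_ball,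
      Metric.mem_ball_self ht₀⟩
    refine ⟨(hfm.const_mul t).exp.aestronglyMeasurable, ?_⟩
    rw [hasFiniteIntegral_iff_ofReal (.of_forall fun x => (Real.exp_pos _).le)]
    exact hmom t (by simpa using ht)
  have hf2 : MemLp f 2 μ := ProbabilityTheory.memLp_of_mem_interior_integrableExpSet hzero 2
  have hfi : Integrable f μ := hf2.integrable (by norm_num)
  set α := ∫ y, f y ∂μ with hα
  have hshift : ∀ t c : ℝ, |t| < t₀ →
      ∫⁻ x, ENNReal.ofReal (Real.exp (c + t * f x)) ∂μ < ⊤ := by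
    intro t c ht
    simp_rw [Real.exp_add, ENNReal.ofReal_mul (Real.exp_pos c).le]
    rw [lintegral_const_mul' _ _ ENNReal.ofReal_ne_top]
    exact ENNReal.mul_lt_top ENNReal.ofReal_lt_top (hmom t ht)
  have hhalf : |t₀ / 2| < t₀ := by rw [abs_of_pos (by linarith)]; linarith
  obtain ⟨C, hC, θ, hθ, hCθ⟩ := hfH
  obtain ⟨δ₁, hδ₁, n₁, h₁⟩ := hB.exists_measure_lt_birkhoff_le (f := fun x => f x - α) hμX' hinv hD
    ⟨C, hC, θ, hθ, fun l hl hl' x hx y hy => by simpa using hCθ l hl hl' x hx y hy⟩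
    (hf2.sub (memLp_const α)) (by rw [integral_sub hfi (integrable_const α)]; simp [hα])
    (half_pos ht₀) (by
      convert hshift (t₀ / 2) (-(t₀ / 2 * α)) hhalf using 5
      ring) hε
  obtain ⟨δ₂, hδ₂, n₂, h₂⟩ := hB.exists_measure_lt_birkhoff_le (f := fun x => α - f x) hμX' hinv hD
    ⟨C, hC, θ, hθ, fun l hl hl' x hx y hy => by
      simpa [abs_sub_comm] using hCθ l hl hl' x hx y hy⟩
    ((memLp_const α).sub hf2) (by rw [integral_sub (integrable_const α) hfi]; simp [hα])
    (half_pos ht₀) (by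
      convert hshift (-(t₀ / 2)) (t₀ / 2 * α) (by rwa [abs_neg]) using 5
      ring) hε
  refine ⟨min δ₁ δ₂, lt_min hδ₁ hδ₂, max n₁ n₂, fun n hn => ?_⟩
  refine ENNReal.toReal_le_of_le_ofReal (Real.exp_pos _).le ?_
  have hle : ∀ δ, min δ₁ δ₂ ≤ δ → ENNReal.ofReal (Real.exp (-(n * δ)) / 2) ≤
      ENNReal.ofReal (Real.exp (-(n * min δ₁ δ₂)) / 2) := fun δ hδ => by gcongr
  have hsub : {x | (n : ℝ) * ε < |birkhoff f n x - n * α|} ⊆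
      {x | n * ε < birkhoff (fun x => f x - α) n x} ∪
        {x | n * ε < birkhoff (fun x => α - f x) n x} := by
    intro x hx
    have e1 : birkhoff (fun x => f x - α) n x = birkhoff f n x - n * α := by simp [birkhoff]
    have e2 : birkhoff (fun x => α - f x) n x = -(birkhoff f n x - n * α) := by simp [birkhoff]
    simp only [mem_union, mem_ofPred_eq, e1, e2]
    exact lt_abs.1 hx
  calc μ {x | (n : ℝ) * ε < |birkhoff f n x - n * α|}
      ≤ _ := (measure_mono hsub).trans (measure_union_le _ _)
    _ ≤ ENNReal.ofReal (Real.exp (-(n * min δ₁ δ₂)) / 2) +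
        ENNReal.ofReal (Real.exp (-(n * min δ₁ δ₂)) / 2) :=
      add_le_add ((h₁ n (le_of_max_le_left hn)).trans (hle _ (min_le_left _ _)))
        ((h₂ n (le_of_max_le_right hn)).trans (hle _ (min_le_right _ _)))
    _ = ENNReal.ofReal (Real.exp (-(n * min δ₁ δ₂))) := by
      rw [← ENNReal.ofReal_add (by positivity) (by positivity), add_halves]
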